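/- arXiv:2411.16397 — 8 statements merged into one kernel-verified Lean document; each statement's English description precedes it below -/
import Mathlib

section
/- For every KA_{x̄,1̄} term t, the inequation 1 ≤ t holds for all valuations over all sets (LANG ⊨ 1 ≤ t) if and only if it holds for all valuations over the empty set (LANG_0 ⊨ 1 ≤ t). -/
/-- Terms of Kleene algebra with variable complements (`nvar`) and the
complemented identity constant (`cone`), over the countably infinite
variable set `ℕ`. -/
inductive Term : Type where
  | var : ℕ → Term
  | nvar : ℕ → Term
  | zero : Term
  | one : Term
  | cone : Term
  | add : Term → Term → Term
  | comp : Term → Term → Term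
  | star : Term → Term

/-- Composition (concatenation) of languages. -/
def cat {X : Type} (L M : Set (List X)) : Set (List X) :=
  {w | ∃ u ∈ L, ∃ v ∈ M, w = u ++ v}

/-- Kleene star of a language. -/
def kstar {X : Type} (L : Set (List X)) : Set (List X) :=
  {w | ∃ ws : List (List X), (∀ u ∈ ws, u ∈ L) ∧ w = ws.flatten}

/-- The interpretation `v̂(t)` of a term under a valuation `v : V → P(X*)`. -/
def eval {X : Type} (v : ℕ → Set (List X)) : Term → Set (List X)
  | .var x => v x
  | .nvar x => (v x)ᶜ
  | .zero => ∅
  | .one => {[]}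
  | .cone => ({[]} : Set (List X))ᶜ
  | .add t s => eval v t ∪ eval v s
  | .comp t s => cat (eval v t) (eval v s)
  | .star t => kstar (eval v t)

/-- Whether the empty word belongs to the value of a term depends only on which variables
contain the empty word. -/
theorem nil_mem_eval_congr {X Y : Type} {v : ℕ → Set (List X)} {w : ℕ → Set (List Y)}
    (h : ∀ x, [] ∈ v x ↔ [] ∈ w x) (t : Term) : [] ∈ eval v t ↔ [] ∈ eval w t := by
  induction t with
  | var x => exact h x
  | nvar x => exact not_congr (h x)
  | zero => simp [eval]
  | one => simp [eval]
  | cone => simp [eval]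
  | add t s iht ihs => exact or_congr iht ihs
  | comp t s iht ihs =>
    have nil_mem_cat {Z : Type} (L M : Set (List Z)) : [] ∈ cat L M ↔ [] ∈ L ∧ [] ∈ M := by
      simp [cat]
    simp only [eval, nil_mem_cat, iht, ihs]
  | star t _ =>
    have nil_mem_kstar {Z : Type} (L : Set (List Z)) : [] ∈ kstar L := ⟨[], by simp⟩
    exact iff_of_true (nil_mem_kstar _) (nil_mem_kstar _)

/-- `LANG ⊨ 1 ≤ t` iff `LANG_0 ⊨ 1 ≤ t` (valuations over sets of
cardinality at most `0`, i.e. over the empty set). -/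
theorem stmt3 (t : Term) :
    (∀ (X : Type) (v : ℕ → Set (List X)), eval v .one ⊆ eval v t) ↔
    (∀ (X : Type), Cardinal.mk X ≤ 0 →
      ∀ v : ℕ → Set (List X), eval v .one ⊆ eval v t) := by
  refine ⟨fun h X _ v => h X v, fun h X v => ?_⟩
  rintro _ rfl
  let w : ℕ → Set (List Empty) := fun x => {_u | [] ∈ v x}
  exact (nil_mem_eval_congr (v := v) (w := w) (fun _ => Iff.rfl) t).mpr
    (h Empty (by simp) w rfl)
end

section
/- Let v be a valuation over a set X and let w ∈ X* be a nonempty word. Then for every KA_{x̄,1̄} term t, if the single letter ℓ belongs to the interpretation of t under the words-to-letters valuation v^⟨w⟩, then w ∈ v̂(t). -/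
/-- The words-to-letters valuation `v^⟨w⟩` over the one-letter alphabet `{ℓ}`
(represented by `Unit`, with `ℓ = ()`):
`v^⟨w⟩(x) = {ε : ε ∈ v(x)} ∪ {ℓ : w ∈ v(x)}`. -/
def wl {X : Type} (v : ℕ → Set (List X)) (w : List X) : ℕ → Set (List Unit) :=
  fun x => {u | (u = [] ∧ [] ∈ v x) ∨ (u = [()] ∧ w ∈ v x)}

/-- The empty word is reflected from the words-to-letters valuation. -/
theorem nil_mem_eval_of_wl {X : Type} (v : ℕ → Set (List X)) (w : List X) (t : Term) :
    [] ∈ eval (wl v w) t → [] ∈ eval v t := by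
  induction t with
  | var x => simp [eval, wl]
  | nvar x => simp [eval, wl]
  | zero => simp [eval]
  | one => simp [eval]
  | cone => simp [eval]
  | add t s iht ihs => exact Or.imp iht ihs
  | comp t s iht ihs =>
    rintro ⟨a, ha, b, hb, hab⟩
    obtain ⟨rfl, rfl⟩ := List.append_eq_nil_iff.mp hab.symm
    exact ⟨[], iht ha, [], ihs hb, rfl⟩
  | star t _ => exact fun _ => ⟨[], by simp, rfl⟩

/-- For a valuation `v` over `X`, a nonempty word `w ∈ X*`, and any
`KA_{x̄,1̄}` term `t`: if the single letter `ℓ` belongs to the interpretation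
of `t` under the words-to-letters valuation `v^⟨w⟩`, then `w ∈ v̂(t)`. -/
theorem stmt4 {X : Type} (v : ℕ → Set (List X)) (w : List X) (hw : w ≠ [])
    (t : Term) :
    [()] ∈ eval (wl v w) t → w ∈ eval v t := by
  induction t with
  | var x => simp [eval, wl]
  | nvar x => simp [eval, wl]
  | zero => simp [eval]
  | one => simp [eval]
  | cone => simp [eval, hw]
  | add t s iht ihs => exact Or.imp iht ihs
  | comp t s iht ihs =>
    rintro ⟨a, ha, b, hb, hab⟩
    obtain ⟨rfl, rfl⟩ | ⟨rfl, rfl⟩ := List.append_eq_singleton_iff.mp hab.symm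
    · exact ⟨[], nil_mem_eval_of_wl v w t ha, w, ihs hb, rfl⟩
    · exact ⟨w, iht ha, [], nil_mem_eval_of_wl v w s hb, by simp⟩
  | star t ih =>
    rintro ⟨ws, hws, h⟩
    obtain ⟨u, hu, hmem⟩ := List.mem_flatten.mp (h ▸ List.mem_singleton_self ())
    have hsub : u.Sublist [()] := h ▸ List.sublist_flatten_of_mem hu
    obtain rfl : u = [()] :=
      hsub.eq_of_length_le (List.length_pos_of_mem hmem)
    exact ⟨[w], by simpa using ih (hws _ hu), by simp⟩
end

section
/- For every variable x ∈ V and every KA_{x̄,1̄} term t, the following are equivalent: (1) LANG ⊨ x ≤ t; (2) v̂(x) ⊆ v̂(t) for every valuation v over a one-letter alphabet {ℓ} such that v(y) ⊆ {ε, ℓ} for all variables y; (3) v̂^⟨w⟩(x) ⊆ v̂^⟨w⟩(t) for every set X, every valuation v over X, and every nonempty word w ∈ X*. -/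
/-- Membership of `ε` or `ℓ` in a term under the words-to-letters valuation `v^⟨w⟩` transfers to
`v` along the monoid homomorphism sending `ℓ` to `w`. -/
theorem flatMap_mem_eval_of_mem_eval_wl {X : Type} (v : ℕ → Set (List X)) (w : List X) (t : Term)
    (u : List Unit) (hsub : u.Sublist [()]) (hw : w = [] → u = []) (hu : u ∈ eval (wl v w) t) :
    u.flatMap (fun _ => w) ∈ eval v t := by
  induction t generalizing u with
  | var y => rcases List.sublist_singleton.1 hsub with rfl | rfl <;> simpa [eval, wl] using hu
  | nvar y => rcases List.sublist_singleton.1 hsub with rfl | rfl <;> simpa [eval, wl] using hu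
  | zero => exact hu
  | one =>
    obtain rfl : u = [] := hu
    rfl
  | cone =>
    rcases List.sublist_singleton.1 hsub with rfl | rfl
    · exact absurd rfl hu
    · simpa [eval] using hw
  | add t s iht ihs =>
    rcases hu with hu | hu
    · exact Or.inl (iht u hsub hw hu)
    · exact Or.inr (ihs u hsub hw hu)
  | comp t s iht ihs =>
    obtain ⟨a, ha, b, hb, rfl⟩ := hu
    exact ⟨a.flatMap (fun _ => w),
      iht a ((List.sublist_append_left a b).trans hsub)
        (fun e => (List.append_eq_nil_iff.1 (hw e)).1) ha,
      b.flatMap (fun _ => w),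
      ihs b ((List.sublist_append_right a b).trans hsub)
        (fun e => (List.append_eq_nil_iff.1 (hw e)).2) hb,
      List.flatMap_append⟩
  | star t ih =>
    obtain ⟨us, hus, rfl⟩ := hu
    refine ⟨us.map (List.flatMap (fun _ => w)), ?_, ?_⟩
    · intro z hz
      obtain ⟨a, ha, rfl⟩ := List.mem_map.1 hz
      exact ih a ((List.sublist_flatten_of_mem ha).trans hsub)
        (fun e => List.flatten_eq_nil_iff.1 (hw e) a ha) (hus a ha)
    · rw [List.flatMap_def, List.map_flatten, List.flatten_flatten, List.map_map]
      rfl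

/-- A valuation over the one-letter alphabet with values inside `{ε, ℓ}` is its own
words-to-letters valuation at `ℓ`. -/
theorem wl_singleton_eq_self (v : ℕ → Set (List Unit)) (hv : ∀ y, v y ⊆ {[], [()]}) :
    wl v [()] = v := by
  funext y
  ext u
  constructor
  · rintro (⟨rfl, h⟩ | ⟨rfl, h⟩) <;> exact h
  · intro h
    rcases hv y h with rfl | rfl
    · exact Or.inl ⟨rfl, h⟩
    · exact Or.inr ⟨rfl, h⟩

/-- For a variable `x` and a `KA_{x̄,1̄}` term `t`, the following are
equivalent: (1) `LANG ⊨ x ≤ t`; (2) `v̂(x) ⊆ v̂(t)` for every valuation `v`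
over the one-letter alphabet `{ℓ}` with `v(y) ⊆ {ε, ℓ}` for all `y`;
(3) `v̂^⟨w⟩(x) ⊆ v̂^⟨w⟩(t)` for every valuation `v` over every set `X` and
every nonempty word `w ∈ X*`. -/
theorem stmt6 (x : ℕ) (t : Term) :
    List.TFAE
      [∀ (X : Type) (v : ℕ → Set (List X)), eval v (.var x) ⊆ eval v t,
       ∀ v : ℕ → Set (List Unit), (∀ y : ℕ, v y ⊆ {[], [()]}) →
         eval v (.var x) ⊆ eval v t,
       ∀ (X : Type) (v : ℕ → Set (List X)) (w : List X), w ≠ [] →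
         eval (wl v w) (.var x) ⊆ eval (wl v w) t] := by
  tfae_have 1 → 3 := fun h X v w _ => h Unit (wl v w)
  tfae_have 3 → 2 := fun h v hv => by
    simpa only [wl_singleton_eq_self v hv] using h Unit v [()] (by simp)
  tfae_have 2 → 1 := fun h X v w hw => by
    have hwl : ∀ y, wl v w y ⊆ {[], [()]} := by
      rintro y u (⟨rfl, -⟩ | ⟨rfl, -⟩) <;> simp
    by_cases hnil : w = []
    · subst hnil
      exact flatMap_mem_eval_of_mem_eval_wl v [] t [] (by simp) (fun _ => rfl)
        (h _ hwl (Or.inl ⟨rfl, hw⟩))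
    · simpa using flatMap_mem_eval_of_mem_eval_wl v w t [()] (by simp) (fun e => absurd e hnil)
        (h _ hwl (Or.inr ⟨rfl, hw⟩))
  tfae_finish
end

section
/- Let v be a valuation over a set X, let n ≥ 0, and let w_0, …, w_{n−1} ∈ X* be nonempty words. Then for every KA_{x̄,1̄} term t and all indices 0 ≤ i ≤ j ≤ n: if the word ℓ_i ℓ_{i+1} ⋯ ℓ_{j−1} belongs to the interpretation of t under the words-to-letters valuation v^⟨w_0,…,w_{n−1}⟩, then the word w_i w_{i+1} ⋯ w_{j−1} belongs to v̂(t). -/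
/-- The word `ℓ_i ℓ_{i+1} ⋯ ℓ_{j-1}` over the `n`-letter alphabet
`{ℓ_0, …, ℓ_{n-1}}` (represented by `Fin n`). -/
def seg (n i j : ℕ) : List (Fin n) :=
  ((List.finRange n).drop i).take (j - i)

/-- The concatenation `w_i w_{i+1} ⋯ w_{j-1}` of the words `w_0, …, w_{n-1}`. -/
def catSeg {X : Type} {n : ℕ} (ws : Fin n → List X) (i j : ℕ) : List X :=
  (((List.ofFn ws).drop i).take (j - i)).flatten

/-- The words-to-letters valuation `v^⟨w_0, …, w_{n-1}⟩`, a valuation over the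
`n`-letter alphabet `{ℓ_0, …, ℓ_{n-1}}` (represented by `Fin n`):
`v^⟨w_0,…,w_{n-1}⟩(x) = {ℓ_i ⋯ ℓ_{j-1} : 0 ≤ i ≤ j ≤ n ∧ w_i ⋯ w_{j-1} ∈ v(x)}`. -/
def wls {X : Type} {n : ℕ} (v : ℕ → Set (List X)) (ws : Fin n → List X) :
    ℕ → Set (List (Fin n)) :=
  fun x => {u | ∃ i j : ℕ, i ≤ j ∧ j ≤ n ∧ u = seg n i j ∧ catSeg ws i j ∈ v x}

theorem catSeg_eq_flatMap {X : Type} {n : ℕ} (ws : Fin n → List X) (i j : ℕ) :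
    catSeg ws i j = (seg n i j).flatMap ws := by
  simp [catSeg, seg, List.flatMap_def, List.map_take, List.map_drop, List.ofFn_eq_map]

theorem seg_infix (n i j : ℕ) : seg n i j <:+: List.finRange n :=
  (List.take_prefix _ _).isInfix.trans (List.drop_suffix _ _).isInfix

/-- Every factor of `ℓ_0 ⋯ ℓ_{n-1}` is of the form `ℓ_i ⋯ ℓ_{j-1}`. -/
theorem exists_eq_seg_of_infix {n : ℕ} {u : List (Fin n)} (hu : u <:+: List.finRange n) :
    ∃ i j : ℕ, i ≤ j ∧ j ≤ n ∧ u = seg n i j := by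
  obtain ⟨a, b, h⟩ := hu
  have hlen := congrArg List.length h
  simp only [List.length_append, List.length_finRange] at hlen
  refine ⟨a.length, a.length + u.length, by omega, by omega, ?_⟩
  simp [seg, ← h]

/-- If a factor `u` of `ℓ_0 ⋯ ℓ_{n-1}` lies in the interpretation of `t` under the words-to-letters
valuation, then substituting the words `ws` for the letters of `u` gives a word of `v̂(t)`. -/
theorem flatMap_mem_eval {X : Type} {n : ℕ} (v : ℕ → Set (List X)) (ws : Fin n → List X)
    (hws : ∀ k, ws k ≠ []) (t : Term) (u : List (Fin n)) (hu : u <:+: List.finRange n)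
    (h : u ∈ eval (wls v ws) t) : u.flatMap ws ∈ eval v t := by
  induction t generalizing u with
  | var x =>
    obtain ⟨i, j, -, -, rfl, hx⟩ := h
    rwa [catSeg_eq_flatMap] at hx
  | nvar x =>
    intro hx
    obtain ⟨i, j, hij, hj, rfl⟩ := exists_eq_seg_of_infix hu
    exact h ⟨i, j, hij, hj, rfl, by rwa [catSeg_eq_flatMap]⟩
  | zero => exact h.elim
  | one =>
    obtain rfl : u = [] := h
    rfl
  | cone =>
    intro hx
    have hx' : u.flatMap ws = [] := hx
    rw [List.flatMap_eq_nil_iff] at hx'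
    exact h (List.eq_nil_iff_forall_not_mem.2 fun k hk => hws k (hx' k hk))
  | add t s iht ihs => exact h.imp (iht u hu) (ihs u hu)
  | comp t s iht ihs =>
    obtain ⟨a, ha, b, hb, rfl⟩ := h
    exact ⟨_, iht a ((List.prefix_append a b).isInfix.trans hu) ha,
      _, ihs b ((List.suffix_append a b).isInfix.trans hu) hb, List.flatMap_append⟩
  | star t ih =>
    obtain ⟨us, hus, rfl⟩ := h
    refine ⟨us.map fun a => a.flatMap ws, ?_, ?_⟩
    · simp only [List.mem_map]
      rintro _ ⟨a, ha, rfl⟩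
      exact ih a ((List.infix_of_mem_flatten ha).trans hu) (hus a ha)
    · simp only [List.flatMap_def, List.map_flatten, List.flatten_flatten, List.map_map,
        Function.comp_def]

/-- For a valuation `v` over `X` and nonempty words `w_0, …, w_{n-1}`:
for every `KA_{x̄,1̄}` term `t` and `0 ≤ i ≤ j ≤ n`, if `ℓ_i ⋯ ℓ_{j-1}`
belongs to the interpretation of `t` under `v^⟨w_0,…,w_{n-1}⟩`, then
`w_i ⋯ w_{j-1} ∈ v̂(t)`. -/
theorem stmt7 {X : Type} {n : ℕ} (v : ℕ → Set (List X)) (ws : Fin n → List X)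
    (hws : ∀ k, ws k ≠ []) (t : Term) (i j : ℕ) (hij : i ≤ j) (hj : j ≤ n) :
    seg n i j ∈ eval (wls v ws) t → catSeg ws i j ∈ eval v t := by
  intro h
  rw [catSeg_eq_flatMap]
  exact flatMap_mem_eval v ws hws t _ (seg_infix n i j) h
end

section
/- Let v be a valuation over a set X, let u = x_0 ⋯ x_{n−1} be a word over the alphabet Ṽ_{1̄} (viewed as a KA_{x̄,1̄} term via composition), and let w ∈ v̂(u). Then there exist m with 0 ≤ m ≤ n and nonempty words w_0, …, w_{m−1} ∈ X* such that w = w_0 ⋯ w_{m−1} and the word ℓ_0 ℓ_1 ⋯ ℓ_{m−1} belongs to the interpretation of u under the words-to-letters valuation v^⟨w_0,…,w_{m−1}⟩. -/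
/-- The alphabet `Ṽ_{1̄} = {x, x̄ : x ∈ V} ∪ {1̄}`. -/
inductive TLetter : Type where
  | pos : ℕ → TLetter
  | neg : ℕ → TLetter
  | one : TLetter
  deriving DecidableEq

/-- A letter of `Ṽ_{1̄}` viewed as a term. -/
def TLetter.toTerm : TLetter → Term
  | .pos x => .var x
  | .neg x => .nvar x
  | .one => .cone

/-- A word over `Ṽ_{1̄}` viewed as a term (composition of its letters,
the empty word being `1`). -/
def wordToTerm : List TLetter → Term
  | [] => .one
  | a :: w => .comp a.toTerm (wordToTerm w)

/-- The regular language `⟦t⟧_{Ṽ1̄}` of `t` read as a regular expression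
over the alphabet `Ṽ_{1̄}`, where each of `x`, `x̄`, `1̄` is a single letter. -/
def syntacticLang : Term → Set (List TLetter)
  | .var x => {[.pos x]}
  | .nvar x => {[.neg x]}
  | .zero => ∅
  | .one => {[]}
  | .cone => {[.one]}
  | .add t s => syntacticLang t ∪ syntacticLang s
  | .comp t s => cat (syntacticLang t) (syntacticLang s)
  | .star t => kstar (syntacticLang t)

theorem catSeg_eq_flatten_map_seg {X : Type} {n : ℕ} (ws : Fin n → List X) (i j : ℕ) :
    catSeg ws i j = ((seg n i j).map ws).flatten := by
  simp [catSeg, seg, List.ofFn_eq_map, List.map_take, List.map_drop]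

theorem mem_wls_iff {X : Type} {n : ℕ} (v : ℕ → Set (List X)) (ws : Fin n → List X)
    {s : List (Fin n)} (hs : s <:+: List.finRange n) (x : ℕ) :
    s ∈ wls v ws x ↔ (s.map ws).flatten ∈ v x := by
  constructor
  · rintro ⟨i, j, -, -, rfl, h⟩
    rwa [catSeg_eq_flatten_map_seg] at h
  · intro h
    obtain ⟨a, b, hab⟩ := hs
    have hseg : s = seg n a.length (a.length + s.length) := by
      simp [seg, ← hab]
    have hlen := congrArg List.length hab
    simp only [List.length_append, List.length_finRange] at hlen
    refine ⟨a.length, a.length + s.length, by omega, by omega, hseg, ?_⟩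
    rwa [catSeg_eq_flatten_map_seg, ← hseg]

theorem mem_eval_wls_toTerm_iff {X : Type} {n : ℕ} (v : ℕ → Set (List X))
    (ws : Fin n → List X) (hws : ∀ k, ws k ≠ []) {s : List (Fin n)}
    (hs : s <:+: List.finRange n) (a : TLetter) :
    s ∈ eval (wls v ws) a.toTerm ↔ (s.map ws).flatten ∈ eval v a.toTerm := by
  cases a with
  | pos x => exact mem_wls_iff v ws hs x
  | neg x => exact not_congr (mem_wls_iff v ws hs x)
  | one => cases s <;> simp [TLetter.toTerm, eval, hws]

/-- The factorization is chosen independently of the ambient alphabet: it works for every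
segment of letters, of any alphabet, whose associated words are the chosen factors. -/
theorem exists_factorization {X : Type} (v : ℕ → Set (List X)) (u : List TLetter) (w : List X)
    (hw : w ∈ eval v (wordToTerm u)) :
    ∃ L : List (List X), L.length ≤ u.length ∧ (∀ p ∈ L, p ≠ []) ∧ w = L.flatten ∧
      ∀ (n : ℕ) (ws : Fin n → List X), (∀ k, ws k ≠ []) →
        ∀ s : List (Fin n), s <:+: List.finRange n → s.map ws = L →
          s ∈ eval (wls v ws) (wordToTerm u) := by
  induction u generalizing w with
  | nil =>
    refine ⟨[], le_rfl, by simp, hw, fun n ws _ s _ hsL => ?_⟩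
    exact List.map_eq_nil_iff.mp hsL
  | cons a u ih =>
    obtain ⟨p, hp, q, hq, rfl⟩ := hw
    obtain ⟨L, hlen, hne, rfl, hL⟩ := ih q hq
    by_cases hp0 : p = []
    · subst hp0
      refine ⟨L, hlen.trans (by simp), hne, rfl, fun n ws hws s hs hsL => ?_⟩
      refine ⟨[], ?_, s, hL n ws hws s hs hsL, rfl⟩
      exact (mem_eval_wls_toTerm_iff v ws hws List.nil_infix a).mpr hp
    · refine ⟨p :: L, by simpa using hlen, by simpa [hp0] using hne, rfl,
        fun n ws hws s hs hsL => ?_⟩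
      obtain ⟨k, s, rfl, rfl, rfl⟩ := List.map_eq_cons_iff.mp hsL
      have hk : [k] <:+: List.finRange n := List.IsInfix.trans ⟨[], s, rfl⟩ hs
      have hs' : s <:+: List.finRange n := (List.suffix_cons k s).isInfix.trans hs
      refine ⟨[k], ?_, s, hL n ws hws s hs' rfl, rfl⟩
      exact (mem_eval_wls_toTerm_iff v ws hws hk a).mpr (by simpa using hp)

/-- Let `u = x_0 ⋯ x_{n-1}` be a word over `Ṽ_{1̄}` and `w ∈ v̂(u)`. Then there
are `m ≤ n` and nonempty words `w_0, …, w_{m-1}` with `w = w_0 ⋯ w_{m-1}` and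
`ℓ_0 ⋯ ℓ_{m-1} ∈ v̂^⟨w_0,…,w_{m-1}⟩(u)`. -/
theorem stmt8 {X : Type} (v : ℕ → Set (List X)) (u : List TLetter) (w : List X)
    (hw : w ∈ eval v (wordToTerm u)) :
    ∃ m : ℕ, m ≤ u.length ∧ ∃ ws : Fin m → List X, (∀ k, ws k ≠ []) ∧
      w = catSeg ws 0 m ∧ seg m 0 m ∈ eval (wls v ws) (wordToTerm u) := by
  obtain ⟨L, hlen, hne, rfl, hL⟩ := exists_factorization v u w hw
  have hws : ∀ k, L.get k ≠ [] := fun k => hne _ (L.get_mem k)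
  have hseg : seg L.length 0 L.length = List.finRange L.length := by simp [seg]
  have hmap : (List.finRange L.length).map L.get = L := by
    rw [← List.ofFn_eq_map, List.ofFn_get]
  refine ⟨L.length, hlen, L.get, hws, ?_, ?_⟩
  · rw [catSeg_eq_flatten_map_seg, hseg, hmap]
  · rw [hseg]
    exact hL _ _ hws _ List.infix_rfl hmap
end

section
/- Let t be a KA_{x̄,1̄} term, let v be a valuation over a set X, and let w ∈ v̂(t). Then there exist a natural number m with m ≤ l(t) (the supremum length of t) and nonempty words w_0, …, w_{m−1} ∈ X* such that w = w_0 ⋯ w_{m−1} and the word ℓ_0 ℓ_1 ⋯ ℓ_{m−1} belongs to the interpretation of t under the words-to-letters valuation v^⟨w_0,…,w_{m−1}⟩. -/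
/-- The supremum length `l(t) ∈ ℕ ∪ {ω}`:
`sup({|w| : w ∈ ⟦t⟧_{Ṽ1̄}} ∪ {0})`. -/
noncomputable def suplen (t : Term) : ℕ∞ :=
  ⨆ w ∈ syntacticLang t, (w.length : ℕ∞)

/-- The valuation over the alphabet of words `List X` under which a sequence of words belongs to
the language of `x` exactly when its concatenation belongs to `v x`. -/
def flattenVal {X : Type} (v : ℕ → Set (List X)) : ℕ → Set (List (List X)) :=
  fun x => {L | L.flatten ∈ v x}

theorem exists_nonempty_split {X : Type} (w : List X) :
    ∃ L : List (List X), [] ∉ L ∧ L.flatten = w ∧ L.length ≤ 1 := by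
  by_cases h : w = []
  · exact ⟨[], by simp [h]⟩
  · exact ⟨[w], by simp [Ne.symm h]⟩

theorem exists_split_of_mem_eval {X : Type} (v : ℕ → Set (List X)) (t : Term) :
    ∀ w ∈ eval v t, ∃ L ∈ eval (flattenVal v) t, [] ∉ L ∧ L.flatten = w ∧
      ∃ a ∈ syntacticLang t, L.length ≤ a.length := by
  induction t with
  | var x =>
    intro w hw
    obtain ⟨L, hne, rfl, hlen⟩ := exists_nonempty_split w
    exact ⟨L, hw, hne, rfl, _, rfl, hlen⟩
  | nvar x =>
    intro w hw
    obtain ⟨L, hne, rfl, hlen⟩ := exists_nonempty_split w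
    exact ⟨L, hw, hne, rfl, _, rfl, hlen⟩
  | zero => exact fun w hw => hw.elim
  | one =>
    rintro w rfl
    exact ⟨[], rfl, by simp, rfl, _, rfl, le_rfl⟩
  | cone =>
    intro w hw
    obtain ⟨L, hne, rfl, hlen⟩ := exists_nonempty_split w
    refine ⟨L, ?_, hne, rfl, _, rfl, hlen⟩
    rintro rfl
    exact hw rfl
  | add t s iht ihs =>
    rintro w (hw | hw)
    · obtain ⟨L, hL, hne, hf, a, ha, hlen⟩ := iht w hw
      exact ⟨L, .inl hL, hne, hf, a, .inl ha, hlen⟩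
    · obtain ⟨L, hL, hne, hf, a, ha, hlen⟩ := ihs w hw
      exact ⟨L, .inr hL, hne, hf, a, .inr ha, hlen⟩
  | comp t s iht ihs =>
    rintro _ ⟨u, hu, w, hw, rfl⟩
    obtain ⟨L, hL, hneL, rfl, a, ha, hlenL⟩ := iht u hu
    obtain ⟨M, hM, hneM, rfl, b, hb, hlenM⟩ := ihs w hw
    refine ⟨L ++ M, ⟨L, hL, M, hM, rfl⟩, by simp [hneL, hneM], by simp,
      a ++ b, ⟨a, ha, b, hb, rfl⟩, ?_⟩
    simpa using add_le_add hlenL hlenM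
  | star t iht =>
    rintro _ ⟨us, hus, rfl⟩
    induction us with
    | nil => exact ⟨[], ⟨[], by simp, rfl⟩, by simp, rfl, [], ⟨[], by simp, rfl⟩, le_rfl⟩
    | cons u us ih =>
      obtain ⟨L, hL, hneL, hfL, a, ha, hlenL⟩ := iht u (hus u (by simp))
      obtain ⟨M, ⟨Ms, hMs, rfl⟩, hneM, hfM, b, ⟨bs, hbs, rfl⟩, hlenM⟩ :=
        ih fun u' hu' => hus u' (by simp [hu'])
      refine ⟨L ++ Ms.flatten, ⟨L :: Ms, List.forall_mem_cons.2 ⟨hL, hMs⟩, rfl⟩, ?_, ?_,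
        a ++ bs.flatten, ⟨a :: bs, List.forall_mem_cons.2 ⟨ha, hbs⟩, rfl⟩, ?_⟩
      · rw [List.mem_append]
        exact not_or.2 ⟨hneL, hneM⟩
      · rw [List.flatten_append, hfL, hfM, List.flatten_cons]
      · rw [List.length_append, List.length_append]
        exact add_le_add hlenL hlenM

theorem flatten_map_seg {X : Type} {n : ℕ} (ws : Fin n → List X) (i j : ℕ) :
    ((seg n i j).map ws).flatten = catSeg ws i j := by
  simp [seg, catSeg, List.ofFn_eq_map, List.map_take, List.map_drop]

theorem exists_seg_of_infix {n : ℕ} {u : List (Fin n)} (h : u <:+: List.finRange n) :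
    ∃ i j : ℕ, i ≤ j ∧ j ≤ n ∧ u = seg n i j := by
  obtain ⟨p, q, h⟩ := h
  have hlen := congrArg List.length h
  simp only [List.length_append, List.length_finRange] at hlen
  exact ⟨p.length, p.length + u.length, by omega, by omega, by simp [seg, ← h]⟩

theorem mem_eval_wls_of_map_mem {X : Type} {n : ℕ} (v : ℕ → Set (List X)) (ws : Fin n → List X)
    (t : Term) : ∀ u : List (Fin n), u <:+: List.finRange n →
      u.map ws ∈ eval (flattenVal v) t → u ∈ eval (wls v ws) t := by
  induction t with
  | var x =>
    intro u hu h
    obtain ⟨i, j, hij, hj, rfl⟩ := exists_seg_of_infix hu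
    refine ⟨i, j, hij, hj, rfl, ?_⟩
    rw [← flatten_map_seg]
    exact h
  | nvar x =>
    rintro u - h ⟨i, j, -, -, rfl, hx⟩
    rw [← flatten_map_seg] at hx
    exact h hx
  | zero => exact fun u _ h => h.elim
  | one => exact fun u _ h => List.map_eq_nil_iff.1 h
  | cone => exact fun u _ h hnil => h (List.map_eq_nil_iff.2 hnil)
  | add t s iht ihs => exact fun u hu h => h.imp (iht u hu) (ihs u hu)
  | comp t s iht ihs =>
    rintro u hu ⟨L, hL, M, hM, h⟩
    obtain ⟨p, q, rfl, rfl, rfl⟩ := List.map_eq_append_iff.1 h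
    exact ⟨p, iht p ((List.prefix_append p q).isInfix.trans hu) hL,
      q, ihs q ((List.suffix_append p q).isInfix.trans hu) hM, rfl⟩
  | star t iht =>
    rintro u hu ⟨Ls, hLs, h⟩
    induction Ls generalizing u with
    | nil => exact ⟨[], by simp, List.map_eq_nil_iff.1 h⟩
    | cons L Ls ih =>
      obtain ⟨p, q, rfl, rfl, hq⟩ := List.map_eq_append_iff.1 h
      obtain ⟨hL, hLs⟩ := List.forall_mem_cons.1 hLs
      obtain ⟨qs, hqs, rfl⟩ := ih q ((List.suffix_append p q).isInfix.trans hu) hLs hq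
      exact ⟨p :: qs, List.forall_mem_cons.2
        ⟨iht p ((List.prefix_append p _).isInfix.trans hu) hL, hqs⟩, rfl⟩

/-- For a `KA_{x̄,1̄}` term `t`, a valuation `v` over `X`, and `w ∈ v̂(t)`,
there are `m ≤ l(t)` and nonempty words `w_0, …, w_{m-1}` such that
`w = w_0 ⋯ w_{m-1}` and `ℓ_0 ⋯ ℓ_{m-1} ∈ v̂^⟨w_0,…,w_{m-1}⟩(t)`. -/
theorem stmt10 {X : Type} (t : Term) (v : ℕ → Set (List X)) (w : List X)
    (hw : w ∈ eval v t) :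
    ∃ m : ℕ, (m : ℕ∞) ≤ suplen t ∧ ∃ ws : Fin m → List X, (∀ k, ws k ≠ []) ∧
      w = catSeg ws 0 m ∧ seg m 0 m ∈ eval (wls v ws) t := by
  obtain ⟨L, hL, hne, rfl, a, ha, hlen⟩ := exists_split_of_mem_eval v t w hw
  have hseg : seg L.length 0 L.length = List.finRange L.length := by simp [seg]
  refine ⟨L.length, ?_, L.get, fun k hk => hne (hk ▸ L.get_mem k), ?_, ?_⟩
  · exact (Nat.cast_le.2 hlen).trans
      (le_iSup₂ (f := fun (b : List TLetter) (_ : b ∈ syntacticLang t) => (b.length : ℕ∞)) a ha)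
  · simp [catSeg]
  · rw [hseg]
    refine mem_eval_wls_of_map_mem v L.get t _ List.infix_rfl ?_
    rwa [← List.ofFn_eq_map, List.ofFn_get]
end

section
/- (Bounded alphabet property.) For all KA_{x̄,1̄} terms t and s: LANG ⊨ t ≤ s if and only if LANG_{l(t)} ⊨ t ≤ s, i.e., v̂(t) ⊆ v̂(s) holds for all valuations over all sets if and only if it holds for all valuations over sets of cardinality at most the supremum length l(t) of t. -/
/-- A relation with a concatenation on the left splits the list on the right. -/
theorem List.Forall₂.exists_append_left {α β : Type*} {R : α → β → Prop} {u u' : List α}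
    {ws : List β} (h : List.Forall₂ R (u ++ u') ws) :
    ∃ xs ys, List.Forall₂ R u xs ∧ List.Forall₂ R u' ys ∧ ws = xs ++ ys :=
  ⟨_, _, (List.forall₂_take_append ws u u' h.flip).flip,
    (List.forall₂_drop_append ws u u' h.flip).flip, (List.take_append_drop u.length ws).symm⟩

theorem List.flatMap_flatten_eq_flatten_map {α β : Type*} (h : α → List β) (ws : List (List α)) :
    ws.flatten.flatMap h = (ws.map (List.flatMap h)).flatten := by
  induction ws with
  | nil => rfl
  | cons w ws ih => simp [ih]

/-- A word belongs to `v̂(t)` iff it factors along some word of the syntactic language of `t`. -/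
theorem mem_eval_iff_exists_forall₂ {X : Type} (v : ℕ → Set (List X)) (t : Term) (w : List X) :
    w ∈ eval v t ↔ ∃ u ∈ syntacticLang t, ∃ ws : List (List X),
      List.Forall₂ (fun a x => x ∈ eval v a.toTerm) u ws ∧ ws.flatten = w := by
  induction t generalizing w with
  | var x => simp [syntacticLang, List.forall₂_cons_left_iff, TLetter.toTerm]
  | nvar x => simp [syntacticLang, List.forall₂_cons_left_iff, TLetter.toTerm]
  | zero => simp [syntacticLang, eval]
  | one => simp [syntacticLang, eval, eq_comm]
  | cone => simp [syntacticLang, List.forall₂_cons_left_iff, TLetter.toTerm]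
  | add t s iht ihs => simp [syntacticLang, eval, iht, ihs, or_and_right, exists_or]
  | comp t s iht ihs =>
    constructor
    · rintro ⟨x, hx, y, hy, rfl⟩
      obtain ⟨u, hu, xs, hxs, rfl⟩ := (iht x).1 hx
      obtain ⟨u', hu', ys, hys, rfl⟩ := (ihs y).1 hy
      exact ⟨u ++ u', ⟨u, hu, u', hu', rfl⟩, xs ++ ys, List.rel_append hxs hys, by simp⟩
    · rintro ⟨_, ⟨u, hu, u', hu', rfl⟩, ws, hws, rfl⟩
      obtain ⟨xs, ys, hxs, hys, rfl⟩ := hws.exists_append_left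
      exact ⟨_, (iht _).2 ⟨u, hu, xs, hxs, rfl⟩, _, (ihs _).2 ⟨u', hu', ys, hys, rfl⟩, by simp⟩
  | star t iht =>
    constructor
    · rintro ⟨xs, hxs, rfl⟩
      induction xs with
      | nil => exact ⟨[], ⟨[], by simp, rfl⟩, [], .nil, rfl⟩
      | cons x xs ih =>
        obtain ⟨hx, hxs⟩ := List.forall_mem_cons.1 hxs
        obtain ⟨_, ⟨us, hus, rfl⟩, ys, hys, hy⟩ := ih hxs
        obtain ⟨u, hu, zs, hzs, rfl⟩ := (iht x).1 hx
        exact ⟨u ++ us.flatten, ⟨u :: us, List.forall_mem_cons.2 ⟨hu, hus⟩, rfl⟩, zs ++ ys,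
          List.rel_append hzs hys, by simp [hy]⟩
    · rintro ⟨_, ⟨us, hus, rfl⟩, ws, hws, rfl⟩
      induction us generalizing ws with
      | nil =>
        obtain rfl := List.forall₂_nil_left_iff.1 hws
        exact ⟨[], by simp, rfl⟩
      | cons u us ih =>
        obtain ⟨hu, hus⟩ := List.forall_mem_cons.1 hus
        obtain ⟨xs, ys, hxs, hys, rfl⟩ := List.Forall₂.exists_append_left hws
        obtain ⟨zs, hzs, hz⟩ := ih hus ys hys
        exact ⟨xs.flatten :: zs, List.forall_mem_cons.2
          ⟨(iht _).2 ⟨u, hu, xs, hxs, rfl⟩, hzs⟩, by simp [hz]⟩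

/-- Nonerasing homomorphisms reflect the interpretation of letters. -/
theorem mem_eval_toTerm_preimage_iff {X Y : Type} (v : ℕ → Set (List X)) (h : Y → List X)
    (hne : ∀ y, h y ≠ []) (a : TLetter) (w : List Y) :
    w ∈ eval (fun x => List.flatMap h ⁻¹' v x) a.toTerm ↔ w.flatMap h ∈ eval v a.toTerm := by
  cases a with
  | pos x => rfl
  | neg x => rfl
  | one => cases w <;> simp [TLetter.toTerm, eval, hne]

/-- Nonerasing homomorphisms map the interpretation of a term under the preimage valuation into
its interpretation under the original one. -/
theorem flatMap_mem_eval_of_mem_preimage {X Y : Type} (v : ℕ → Set (List X)) (h : Y → List X)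
    (hne : ∀ y, h y ≠ []) (t : Term) (w : List Y)
    (hw : w ∈ eval (fun x => List.flatMap h ⁻¹' v x) t) : w.flatMap h ∈ eval v t := by
  obtain ⟨u, hu, ws, hws, rfl⟩ := (mem_eval_iff_exists_forall₂ _ _ _).1 hw
  refine (mem_eval_iff_exists_forall₂ _ _ _).2 ⟨u, hu, ws.map (List.flatMap h), ?_, ?_⟩
  · exact List.forall₂_map_right_iff.2
      (hws.imp fun a x => (mem_eval_toTerm_preimage_iff v h hne a x).1)
  · exact (List.flatMap_flatten_eq_flatten_map h ws).symm

/-- Every list of words is the image of a list of words over an alphabet with at most as many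
letters as there are words, under a nonerasing homomorphism. -/
theorem exists_nonerasing_map_eq {X : Type} (ws : List (List X)) :
    ∃ (Y : Type) (h : Y → List X), Cardinal.mk Y ≤ ws.length ∧ (∀ y, h y ≠ []) ∧
      ∃ us : List (List Y), us.map (List.flatMap h) = ws := by
  classical
  refine ⟨{i : Fin ws.length // ws.get i ≠ []}, fun i => ws.get i, ?_, fun y => y.2,
    List.ofFn fun i => if hi : ws.get i ≠ [] then [⟨i, hi⟩] else [], ?_⟩
  · exact (Cardinal.mk_subtype_le _).trans_eq (Cardinal.mk_fin _)
  · rw [List.map_ofFn]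
    conv_rhs => rw [← List.ofFn_get ws]
    congr 1
    funext i
    by_cases hi : ws.get i = [] <;> simp_all

/-- Bounded alphabet property: `LANG ⊨ t ≤ s` iff `LANG_{l(t)} ⊨ t ≤ s`,
i.e. iff `v̂(t) ⊆ v̂(s)` for all valuations over sets of cardinality at most
the supremum length `l(t)` of `t`. -/
theorem stmt12 (t s : Term) :
    (∀ (X : Type) (v : ℕ → Set (List X)), eval v t ⊆ eval v s) ↔
    (∀ (X : Type), Cardinal.mk X ≤ Cardinal.ofENat (suplen t) →
      ∀ v : ℕ → Set (List X), eval v t ⊆ eval v s) := by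
  refine ⟨fun H X _ => H X, fun H X v w hw => ?_⟩
  obtain ⟨u, hu, ws, hws, rfl⟩ := (mem_eval_iff_exists_forall₂ _ _ _).1 hw
  obtain ⟨Y, h, hY, hne, us, rfl⟩ := exists_nonerasing_map_eq ws
  have hlen : (u.length : ℕ∞) ≤ suplen t :=
    le_iSup₂ (f := fun (w : List TLetter) (_ : w ∈ syntacticLang t) => (w.length : ℕ∞)) u hu
  have hcard : Cardinal.mk Y ≤ Cardinal.ofENat (suplen t) := by
    rw [← hws.length_eq] at hY
    exact hY.trans (Cardinal.nat_le_ofENat.2 hlen)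
  have hmem : us.flatten ∈ eval (fun x => List.flatMap h ⁻¹' v x) t :=
    (mem_eval_iff_exists_forall₂ _ _ _).2 ⟨u, hu, us, (List.forall₂_map_right_iff.1 hws).imp
      fun a x => (mem_eval_toTerm_preimage_iff v h hne a x).2, rfl⟩
  rw [← List.flatMap_flatten_eq_flatten_map]
  exact flatMap_mem_eval_of_mem_preimage v h hne s _ (H Y hcard _ hmem)
end

section
/- For all words u₁ and u₂ over the alphabet Ṽ_{1̄} (each viewed as a KA_{x̄,1̄} term via composition): LANG_1 ⊨ u₁ = u₂ if and only if u₂ can be obtained from u₁ by permuting its letters, i.e., for every letter a ∈ Ṽ_{1̄}, the number of occurrences of a in u₁ equals the number of occurrences of a in u₂ (equivalently, u₁ = u₂ is derivable from the commutativity equations {x ; y = y ; x : x, y ∈ Ṽ_{1̄}} by equational reasoning). -/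
/-- Over an alphabet with at most one letter, composition of languages is commutative. -/
theorem cat_comm {X : Type} [Subsingleton X] (L M : Set (List X)) : cat L M = cat M L := by
  have append_comm (u w : List X) : u ++ w = w ++ u :=
    List.ext_getElem (by simp [Nat.add_comm]) fun _ _ _ => Subsingleton.elim _ _
  ext w
  constructor
  · rintro ⟨a, ha, b, hb, rfl⟩
    exact ⟨b, hb, a, ha, append_comm a b⟩
  · rintro ⟨a, ha, b, hb, rfl⟩
    exact ⟨b, hb, a, ha, append_comm a b⟩

theorem cat_assoc {X : Type} (L M N : Set (List X)) :
    cat (cat L M) N = cat L (cat M N) := by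
  ext w
  constructor
  · rintro ⟨_, ⟨a, ha, b, hb, rfl⟩, c, hc, rfl⟩
    exact ⟨a, ha, b ++ c, ⟨b, hb, c, hc, rfl⟩, by simp⟩
  · rintro ⟨a, ha, _, ⟨b, hb, c, hc, rfl⟩, rfl⟩
    exact ⟨a ++ b, ⟨a, ha, b, hb, rfl⟩, c, hc, by simp⟩

theorem eval_wordToTerm_of_perm {X : Type} [Subsingleton X] (v : ℕ → Set (List X))
    {u₁ u₂ : List TLetter} (h : u₁.Perm u₂) :
    eval v (wordToTerm u₁) = eval v (wordToTerm u₂) := by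
  induction h with
  | nil => rfl
  | cons a _ ih => simp only [wordToTerm, eval, ih]
  | swap a b l =>
    simp only [wordToTerm, eval]
    rw [← cat_assoc, cat_comm (eval v b.toTerm), cat_assoc]
  | trans _ _ ih₁ ih₂ => exact ih₁.trans ih₂

theorem isLeast_length_cat {X : Type} {L M : Set (List X)} {m n : ℕ}
    (hL : IsLeast (List.length '' L) m) (hM : IsLeast (List.length '' M) n) :
    IsLeast (List.length '' cat L M) (m + n) := by
  obtain ⟨⟨a, ha, rfl⟩, hm⟩ := hL
  obtain ⟨⟨b, hb, rfl⟩, hn⟩ := hM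
  refine ⟨⟨a ++ b, ⟨a, ha, b, hb, rfl⟩, List.length_append⟩, ?_⟩
  rintro _ ⟨_, ⟨c, hc, d, hd, rfl⟩, rfl⟩
  rw [List.length_append]
  exact Nat.add_le_add (hm ⟨c, hc, rfl⟩) (hn ⟨d, hd, rfl⟩)

/-- If `f a` is the minimal length of a word in the language of each letter `a`, then the
minimal length of a word in the language of `u` is the sum of `f` over the letters of `u`. -/
theorem isLeast_length_eval_wordToTerm {X : Type} {v : ℕ → Set (List X)} {f : TLetter → ℕ}
    (hf : ∀ a : TLetter, IsLeast (List.length '' eval v a.toTerm) (f a)) (u : List TLetter) :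
    IsLeast (List.length '' eval v (wordToTerm u)) (u.map f).sum := by
  induction u with
  | nil => simp [wordToTerm, eval]
  | cons a u ih => exact isLeast_length_cat (hf a) ih

theorem isLeast_length_setOf_le (n : ℕ) :
    IsLeast (List.length '' {w : List Unit | n ≤ w.length}) n := by
  refine ⟨⟨List.replicate n (), by simp, by simp⟩, ?_⟩
  rintro _ ⟨w, hw, rfl⟩
  exact hw

theorem isLeast_length_setOf_lt {n : ℕ} (hn : 0 < n) :
    IsLeast (List.length '' {w : List Unit | w.length < n}) 0 :=
  ⟨⟨[], hn, rfl⟩, fun _ _ => Nat.zero_le _⟩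

theorem isLeast_length_compl_nil :
    IsLeast (List.length '' ({[]} : Set (List Unit))ᶜ) 1 := by
  convert isLeast_length_setOf_le 1 using 2
  ext w
  simp [Nat.one_le_iff_ne_zero]

/-- The letter weight charging `c x` for each `x̄`, nothing for `x`, and `1` for `1̄`. -/
def negWeight (c : ℕ → ℕ) : TLetter → ℕ
  | .pos _ => 0
  | .neg x => c x
  | .one => 1

/-- The letter weight charging `c x` for each `x`, nothing for `x̄`, and `1` for `1̄`. -/
def posWeight (c : ℕ → ℕ) : TLetter → ℕ
  | .pos x => c x
  | .neg _ => 0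
  | .one => 1

theorem sum_map_eq_of_isLeast {u₁ u₂ : List TLetter}
    (h : ∀ v : ℕ → Set (List Unit), eval v (wordToTerm u₁) = eval v (wordToTerm u₂))
    {v : ℕ → Set (List Unit)} {f : TLetter → ℕ}
    (hf : ∀ a : TLetter, IsLeast (List.length '' eval v a.toTerm) (f a)) :
    (u₁.map f).sum = (u₂.map f).sum := by
  have h₁ := isLeast_length_eval_wordToTerm hf u₁
  rw [h v] at h₁
  exact h₁.unique (isLeast_length_eval_wordToTerm hf u₂)

theorem sum_map_negWeight_eq {u₁ u₂ : List TLetter}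
    (h : ∀ v : ℕ → Set (List Unit), eval v (wordToTerm u₁) = eval v (wordToTerm u₂))
    {c : ℕ → ℕ} (hc : ∀ x, 0 < c x) :
    (u₁.map (negWeight c)).sum = (u₂.map (negWeight c)).sum := by
  refine sum_map_eq_of_isLeast h (v := fun x => {w | w.length < c x}) ?_
  rintro (x | x | _)
  · exact isLeast_length_setOf_lt (hc x)
  · simpa [TLetter.toTerm, eval, Set.compl_ofPred] using! isLeast_length_setOf_le (c x)
  · exact isLeast_length_compl_nil

theorem sum_map_posWeight_eq {u₁ u₂ : List TLetter}
    (h : ∀ v : ℕ → Set (List Unit), eval v (wordToTerm u₁) = eval v (wordToTerm u₂))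
    {c : ℕ → ℕ} (hc : ∀ x, 0 < c x) :
    (u₁.map (posWeight c)).sum = (u₂.map (posWeight c)).sum := by
  refine sum_map_eq_of_isLeast h (v := fun x => {w | c x ≤ w.length}) ?_
  rintro (x | x | _)
  · exact isLeast_length_setOf_le (c x)
  · simpa [TLetter.toTerm, eval, Set.compl_ofPred] using! isLeast_length_setOf_lt (hc x)
  · exact isLeast_length_compl_nil

/-- Raising the weight of a single letter by one raises the total weight by its count. -/
theorem sum_map_eq_add_count {f g : TLetter → ℕ} {a : TLetter}
    (hg : ∀ b, g b = f b + if b = a then 1 else 0) (u : List TLetter) :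
    (u.map g).sum = (u.map f).sum + u.count a := by
  induction u with
  | nil => rfl
  | cons b u ih =>
    simp only [List.map_cons, List.sum_cons, List.count_cons, ih, hg, beq_iff_eq]
    omega

theorem sum_map_negWeight_one (u : List TLetter) :
    (u.map (negWeight fun _ => 1)).sum = u.count .one + (u.filter (· matches .neg _)).length := by
  induction u with
  | nil => rfl
  | cons b u ih => cases b <;> simp [ih, negWeight] <;> omega

theorem count_eq_of_eval_eq {u₁ u₂ : List TLetter}
    (h : ∀ v : ℕ → Set (List Unit), eval v (wordToTerm u₁) = eval v (wordToTerm u₂))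
    (a : TLetter) : u₁.count a = u₂.count a := by
  have bump_pos (x y : ℕ) : 0 < 1 + if y = x then 1 else 0 := by omega
  have hneg (x : ℕ) : u₁.count (.neg x) = u₂.count (.neg x) := by
    have hw (b : TLetter) : negWeight (fun y => 1 + if y = x then 1 else 0) b =
        negWeight (fun _ => 1) b + if b = .neg x then 1 else 0 := by
      cases b <;> simp [negWeight]
    have h₁ := sum_map_negWeight_eq h (fun _ => Nat.one_pos)
    have h₂ := sum_map_negWeight_eq h (bump_pos x)
    rw [sum_map_eq_add_count hw, sum_map_eq_add_count hw] at h₂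
    omega
  match a with
  | .neg x => exact hneg x
  | .pos x =>
    have hw (b : TLetter) : posWeight (fun y => 1 + if y = x then 1 else 0) b =
        posWeight (fun _ => 1) b + if b = .pos x then 1 else 0 := by
      cases b <;> simp [posWeight]
    have h₁ := sum_map_posWeight_eq h (fun _ => Nat.one_pos)
    have h₂ := sum_map_posWeight_eq h (bump_pos x)
    rw [sum_map_eq_add_count hw, sum_map_eq_add_count hw] at h₂
    omega
  | .one =>
    have hperm : (u₁.filter (· matches .neg _)).Perm (u₂.filter (· matches .neg _)) := by
      rw [List.perm_iff_count]
      rintro (x | x | _)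
      · rw [List.count_eq_zero_of_not_mem, List.count_eq_zero_of_not_mem] <;> simp
      · rw [List.count_filter rfl, List.count_filter rfl, hneg]
      · rw [List.count_eq_zero_of_not_mem, List.count_eq_zero_of_not_mem] <;> simp
    have h₁ := sum_map_negWeight_eq h (fun _ => Nat.one_pos)
    rw [sum_map_negWeight_one, sum_map_negWeight_one, hperm.length_eq] at h₁
    omega

/-- For words `u₁`, `u₂` over `Ṽ_{1̄}` (viewed as terms via composition):
`LANG_1 ⊨ u₁ = u₂` iff `u₂` is a letter-permutation of `u₁`, i.e. every
letter `a ∈ Ṽ_{1̄}` occurs in `u₁` and `u₂` the same number of times. -/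
theorem stmt19 (u₁ u₂ : List TLetter) :
    (∀ (X : Type), Cardinal.mk X ≤ 1 →
      ∀ v : ℕ → Set (List X),
        eval v (wordToTerm u₁) = eval v (wordToTerm u₂)) ↔
    (∀ a : TLetter, u₁.count a = u₂.count a) := by
  constructor
  · intro h
    exact count_eq_of_eval_eq (h Unit (by simp))
  · intro h X hX v
    have := Cardinal.le_one_iff_subsingleton.mp hX
    exact eval_wordToTerm_of_perm v (List.perm_iff_count.mpr h)
end
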